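/- Let q be a prime power and fix a nonnegative integer ℓ. Then, as k → ∞ and n − k → ∞ (with ℓ ≤ k ≤ n − ℓ), the ratio |HHull[n,k]^ℓ_{q²}| / [n choose k]_{q²} converges to q^ℓ · g_{q,∞} · g_{q⁴,∞} / ( h_{q²,ℓ} · g_{q²,∞} · g_{q²,∞} ), where h_{Q,ℓ} = ∏_{i=1}^{ℓ}(Q^i − 1) and g_{Q,∞} = ∏_{i=1}^{∞}(1 − Q^{−i}). In particular, for ℓ = 0 the ratio of the number of Hermitian LCD [n,k]_{q²} codes to [n choose k]_{q²} converges to g_{q,∞} · g_{q⁴,∞} / (g_{q²,∞} · g_{q²,∞}). -/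

import Mathlib

open scoped BigOperators
open Matrix

noncomputable section

/-- The Hermitian inner product `⟨x,y⟩_H = ∑ i, x i * (y i)^q`, where the conjugation
`x ↦ x^q` is given by the ring homomorphism `σ`. -/
def hermInner {K : Type*} [Field K] {n : ℕ} (σ : K →+* K) (x y : Fin n → K) : K :=
  ∑ i, x i * σ (y i)

/-- The Hermitian dual `C^{⊥H} = {y | ⟨x,y⟩_H = 0 for all x ∈ C}` of a code `C ⊆ K^n`. -/
def hermDual {K : Type*} [Field K] {n : ℕ} (σ : K →+* K) (C : Submodule K (Fin n → K)) :
    Submodule K (Fin n → K) where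
  carrier := {y | ∀ x ∈ C, hermInner σ x y = 0}
  zero_mem' := by
    intro x hx
    simp [hermInner]
  add_mem' := by
    intro y z hy hz x hx
    have h1 := hy x hx
    have h2 := hz x hx
    simp only [hermInner, Pi.add_apply, map_add, mul_add, Finset.sum_add_distrib] at h1 h2 ⊢
    rw [h1, h2, add_zero]
  smul_mem' := by
    intro c y hy x hx
    have h := hy x hx
    simp only [hermInner, Pi.smul_apply, smul_eq_mul, _root_.map_mul] at h ⊢
    calc ∑ i, x i * (σ c * σ (y i)) = σ c * ∑ i, x i * σ (y i) := by
          rw [Finset.mul_sum]; exact Finset.sum_congr rfl fun i _ => by ring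
      _ = 0 := by rw [h, mul_zero]

/-- `g_{Q,∞} = ∏_{i=1}^{∞} (1 - Q^{-i})`. -/
def ginfty (Q : ℝ) : ℝ := ∏' i : ℕ, (1 - Q⁻¹ ^ (i + 1))

/-- `h_{Q,ℓ} = ∏_{i=1}^{ℓ} (Q^i - 1)`. -/
def hpoly (Q : ℝ) (ℓ : ℕ) : ℝ := ∏ i ∈ Finset.Icc 1 ℓ, (Q ^ i - 1)

/-- The Gaussian binomial coefficient `[n choose k]_Q = ∏_{i=0}^{k-1} (Q^{n-i}-1)/(Q^{k-i}-1)`. -/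
def gaussBinom (Q : ℝ) (n k : ℕ) : ℝ :=
  ∏ i ∈ Finset.range k, (Q ^ (n - i) - 1) / (Q ^ (k - i) - 1)

open Finset in
/-- Newton products. -/
def PP (Q : ℝ) (j : ℕ) (x : ℝ) : ℝ := ∏ i ∈ range j, (x - Q ^ i)

section count
variable {K : Type*} [Field K] [Fintype K]

lemma PP_eq_zero (Q : ℝ) {j h : ℕ} (hj : h < j) : PP Q j (Q ^ h) = 0 :=
  Finset.prod_eq_zero (Finset.mem_range.2 hj) (sub_self _)

lemma PP_pos {Q : ℝ} (hQ : 1 < Q) {j h : ℕ} (hj : j ≤ h) : 0 < PP Q j (Q ^ h) :=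
  Finset.prod_pos fun i hi => sub_pos.2 (pow_lt_pow_right₀ hQ (by simp at hi; omega))

lemma card_indep (V : Type*) [AddCommGroup V] [Module K V] [Finite V] (j : ℕ) :
    (Nat.card {s : Fin j → V // LinearIndependent K s} : ℝ)
      = PP (Fintype.card K) j ((Fintype.card K : ℝ) ^ Module.finrank K V) := by
  have : Module.Finite K V := Module.Finite.of_finite
  by_cases h : j ≤ Module.finrank K V
  · rw [card_linearIndependent h, PP, ← Fin.prod_univ_eq_prod_range
      (fun i => (Fintype.card K : ℝ) ^ Module.finrank K V - (Fintype.card K : ℝ) ^ i)]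
    push_cast
    refine Finset.prod_congr rfl fun i _ => ?_
    rw [Nat.cast_sub]
    · simp
    · exact Nat.pow_le_pow_right Fintype.card_pos (by omega)
  · rw [PP_eq_zero _ (by omega)]
    have : IsEmpty {s : Fin j → V // LinearIndependent K s} := ⟨fun s => h (by
      simpa using s.2.fintype_card_le_finrank)⟩
    simp

lemma card_indep_in {V : Type*} [AddCommGroup V] [Module K V] [Finite V] (j : ℕ)
    (H : Submodule K V) :
    (Nat.card {s : Fin j → V // LinearIndependent K s ∧ ∀ a, s a ∈ H} : ℝ)
      = PP (Fintype.card K) j ((Fintype.card K : ℝ) ^ Module.finrank K H) := by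
  rw [← card_indep]
  norm_cast
  refine Nat.card_congr ⟨fun s => ⟨fun a => ⟨s.1 a, s.2.2 a⟩, ?_⟩,
    fun s => ⟨fun a => (s.1 a : V), ?_, fun a => (s.1 a).2⟩, fun _ => rfl, fun _ => rfl⟩
  · exact LinearIndependent.of_comp H.subtype s.2.1
  · exact s.2.map' H.subtype (Submodule.ker_subtype H)

lemma card_sub (V : Type*) [AddCommGroup V] [Module K V] [Finite V] (k : ℕ) :
    (Nat.card {C : Submodule K V // Module.finrank K C = k} : ℝ)
      * PP (Fintype.card K) k ((Fintype.card K : ℝ) ^ k)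
      = PP (Fintype.card K) k ((Fintype.card K : ℝ) ^ Module.finrank K V) := by
  classical
  have : Module.Finite K V := Module.Finite.of_finite
  rw [← card_indep]
  let e : {s : Fin k → V // LinearIndependent K s} ≃
      Σ C : {C : Submodule K V // Module.finrank K C = k},
        {s : Fin k → V // LinearIndependent K s ∧ ∀ a, s a ∈ C.1} :=
    { toFun := fun s => ⟨⟨Submodule.span K (Set.range s.1), by
          simpa using finrank_span_eq_card s.2⟩, ⟨s.1, s.2, fun a =>
            Submodule.subset_span ⟨a, rfl⟩⟩⟩
      invFun := fun p => ⟨p.2.1, p.2.2.1⟩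
      left_inv := fun s => rfl
      right_inv := by
        rintro ⟨⟨C, hC⟩, ⟨s, hs, hsC⟩⟩
        have : Submodule.span K (Set.range s) = C := by
          apply Submodule.eq_of_le_of_finrank_eq
          · exact Submodule.span_le.2 (by rintro _ ⟨a, rfl⟩; exact hsC a)
          · rw [hC]; simpa using finrank_span_eq_card hs
        subst this
        rfl }
  have : Fintype {C : Submodule K V // Module.finrank K C = k} := Fintype.ofFinite _
  rw [Nat.card_congr e, Nat.card_sigma]
  push_cast
  simp_rw [card_indep_in]
  rw [Finset.sum_congr rfl (g := fun _ => PP (Fintype.card K) k ((Fintype.card K : ℝ) ^ k))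
    (fun C _ => by rw [C.2])]
  simp

lemma finrank_comap_mkQ {V : Type*} [AddCommGroup V] [Module K V] [Module.Finite K V]
    (D : Submodule K V) (C : Submodule K (V ⧸ D)) :
    Module.finrank K (C.comap D.mkQ) = Module.finrank K C + Module.finrank K D := by
  have h := LinearMap.finrank_range_add_finrank_ker (D.mkQ.domRestrict (C.comap D.mkQ))
  rw [← h, LinearMap.range_domRestrict, Submodule.map_comap_eq_of_surjective D.mkQ_surjective]
  congr 1
  rw [LinearMap.ker_domRestrict, Submodule.ker_mkQ]
  exact LinearEquiv.finrank_eq (Submodule.submoduleOfEquivOfLe (D.le_comap_mkQ C))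

lemma card_between {V : Type*} [AddCommGroup V] [Module K V] [Finite V] {k j d : ℕ} (hjk : j ≤ k)
    (D W : Submodule K V) (hDW : D ≤ W) (hD : Module.finrank K D = j)
    (hW : Module.finrank K W = d) :
    (Nat.card {C : Submodule K V // Module.finrank K C = k ∧ D ≤ C ∧ C ≤ W} : ℝ)
      * PP (Fintype.card K) (k - j) ((Fintype.card K : ℝ) ^ (k - j))
      = PP (Fintype.card K) (k - j) ((Fintype.card K : ℝ) ^ (d - j)) := by
  have : Module.Finite K V := Module.Finite.of_finite
  set D' := D.submoduleOf W
  have hD' : Module.finrank K D' = j := by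
    rw [← hD]; exact LinearEquiv.finrank_eq (Submodule.submoduleOfEquivOfLe hDW)
  have hq : Module.finrank K (W ⧸ D') = d - j := by
    have := D'.finrank_quotient_add_finrank
    omega
  have : Finite (W ⧸ D') := Finite.of_surjective _ D'.mkQ_surjective
  rw [← hq, ← card_sub]
  congr 2
  symm
  refine Nat.card_eq_of_bijective (fun C => ⟨(C.1.comap D'.mkQ).map W.subtype, ?_, ?_, ?_⟩) ⟨?_, ?_⟩
  · rw [LinearEquiv.finrank_eq (Submodule.equivMapOfInjective _ W.subtype_injective _).symm,
      finrank_comap_mkQ, C.2, hD']; omega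
  · intro x hx
    exact ⟨⟨x, hDW hx⟩, D'.le_comap_mkQ C.1 hx, rfl⟩
  · exact Submodule.map_subtype_le _ _
  · intro C C' h
    have h1 := Submodule.map_injective_of_injective W.subtype_injective (Subtype.ext_iff.1 h)
    exact Subtype.ext (Submodule.comap_injective_of_surjective D'.mkQ_surjective h1)
  · rintro ⟨C, hC, hDC, hCW⟩
    have h1 : (Submodule.comap D'.mkQ (Submodule.map D'.mkQ (C.submoduleOf W))) = C.submoduleOf W := by
      rw [Submodule.comap_map_mkQ, sup_eq_right]
      exact fun x hx => hDC hx
    have h2 : Module.finrank K (C.submoduleOf W) = k := by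
      rw [← hC]; exact LinearEquiv.finrank_eq (Submodule.submoduleOfEquivOfLe hCW)
    refine ⟨⟨Submodule.map D'.mkQ (C.submoduleOf W), ?_⟩, ?_⟩
    · have := finrank_comap_mkQ D' (Submodule.map D'.mkQ (C.submoduleOf W))
      rw [h1, h2, hD'] at this
      omega
    · apply Subtype.ext
      simp only [h1]
      rw [Submodule.submoduleOf, Submodule.map_comap_subtype, inf_eq_right.2 hCW]
end count
section herm
open Finset

lemma variance_bound {W α : Type*} [Fintype W] [DecidableEq W] [DecidableEq α] (S : Finset α)
    (q : ℕ) (hq : 0 < q)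
    (hS : S.card ≤ q) (f : W → α) (hf : ∀ w, f w ∈ S) (R : ℝ)
    (hp : (∑ v : W, ∑ w : W, if f v = f w then (1:ℝ) else 0) ≤
      R * Fintype.card W + (Fintype.card W : ℝ) ^ 2 / q) (c : α) (hc : c ∈ S) :
    (((univ.filter fun w => f w = c).card : ℝ) - Fintype.card W / q) ^ 2
      ≤ R * Fintype.card W := by
  set M : ℝ := (Fintype.card W : ℝ) with hM
  have hqr : (0:ℝ) < q := by exact_mod_cast hq
  set N : α → ℝ := fun c => ((univ.filter fun w => f w = c).card : ℝ) with hN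
  have h1 : ∑ c ∈ S, N c = M := by
    have := Finset.card_eq_sum_card_fiberwise (s := (univ : Finset W)) (t := S) (f := f)
      (fun w _ => hf w)
    simp only [M, hN, Fintype.card]
    exact_mod_cast this.symm
  have h2 : ∑ c ∈ S, N c ^ 2 = ∑ v : W, ∑ w : W, if f v = f w then (1:ℝ) else 0 := by
    have h3 : ∀ v : W, (∑ w : W, if f v = f w then (1:ℝ) else 0) = N (f v) := by
      intro v
      rw [Finset.sum_boole]
      simp only [hN, eq_comm]
    simp_rw [h3]
    rw [← Finset.sum_fiberwise_of_maps_to (g := f) (t := S) (fun w _ => hf w)]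
    refine Finset.sum_congr rfl fun c _ => ?_
    rw [Finset.sum_congr rfl (g := fun _ => N c)]
    · simp [hN, sq]
    · intro x hx
      rw [(Finset.mem_filter.1 hx).2]
  have h4 : (N c - M / q) ^ 2 ≤ ∑ c ∈ S, (N c - M / q) ^ 2 :=
    Finset.single_le_sum (f := fun c => (N c - M / q) ^ 2) (fun _ _ => sq_nonneg _) hc
  have h5 : ∑ c ∈ S, (N c - M / q) ^ 2 = ∑ c ∈ S, N c ^ 2 - 2 * (M / q) * M
      + S.card * (M / q) ^ 2 := by
    rw [← h1, Finset.mul_sum, h1]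
    simp_rw [sub_sq, Finset.sum_add_distrib, Finset.sum_sub_distrib]
    simp only [sum_const, nsmul_eq_mul]
    congr 2
    exact Finset.sum_congr rfl fun _ _ => by ring
  have h6 : (S.card : ℝ) * (M / q) ^ 2 ≤ q * (M / q) ^ 2 :=
    mul_le_mul_of_nonneg_right (by exact_mod_cast hS) (sq_nonneg _)
  have h7 : (q:ℝ) * (M / q) ^ 2 = M ^ 2 / q := by field_simp
  have h8 : 2 * (M / q) * M = 2 * (M ^ 2 / q) := by ring
  change (N c - M / q) ^ 2 ≤ _
  rw [← h2] at hp
  linarith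

variable {K : Type*} [Field K] [Fintype K]

lemma card_preimage {W : Type*} [AddCommGroup W] [Module K W] [Fintype W] [DecidableEq K]
    (φ : W →ₗ[K] K) (hφ : ∃ w, φ w ≠ 0) (R : Finset K) :
    (univ.filter fun w => φ w ∈ R).card * Fintype.card K = R.card * Fintype.card W := by
  obtain ⟨w0, hw0⟩ := hφ
  have hsurj : ∀ c : K, c ∈ Set.range φ.toAddMonoidHom := fun c =>
    ⟨(c / φ w0) • w0, by simp [hw0]⟩
  have hfib : ∀ c : K, (univ.filter fun w => φ w = c).card = (univ.filter fun w => φ w = 0).card :=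
    fun c => AddMonoidHom.card_fiber_eq_of_mem_range φ.toAddMonoidHom (hsurj c) (hsurj 0)
  have hsum : ∀ R : Finset K, (univ.filter fun w => φ w ∈ R).card
      = R.card * (univ.filter fun w => φ w = 0).card := by
    intro R
    rw [Finset.card_eq_sum_card_fiberwise (t := R) (f := φ) (fun w hw => by simpa using hw)]
    rw [Finset.sum_congr rfl (g := fun _ => (univ.filter fun w => φ w = 0).card)]
    · simp
    · intro c hc
      rw [← hfib c, Finset.filter_filter]
      congr 1
      ext w; simp; rintro rfl; exact hc
  have h1 := hsum univ
  simp only [mem_univ, filter_true] at h1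
  rw [hsum R, ← Finset.card_univ (α := W), h1, Finset.card_univ]
  ring

open Polynomial in
lemma card_roots_tr [DecidableEq K] (q : ℕ) (hq : 2 ≤ q) (a c : K) :
    (univ.filter fun x : K => x ^ q + a * x + c = 0).card ≤ q := by
  have hdeg : (X ^ q + C a * X + C c : K[X]).natDegree = q := by
    compute_degree!
    · rw [if_neg (by omega), if_neg (by omega)]; simp
    all_goals omega
  have hne : (X ^ q + C a * X + C c : K[X]) ≠ 0 := by
    intro h; rw [h] at hdeg; simp at hdeg; omega
  calc _ ≤ (X ^ q + C a * X + C c : K[X]).roots.toFinset.card := by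
        apply Finset.card_le_card
        intro x hx
        simp only [mem_filter, mem_univ, true_and] at hx
        simp [hne, hx]
    _ ≤ _ := (Multiset.toFinset_card_le _).trans ((Polynomial.card_roots' _).trans hdeg.le)

variable {n : ℕ} (σ : K →+* K)

lemma hermInner_add_left (x y z : Fin n → K) :
    hermInner σ (x + y) z = hermInner σ x z + hermInner σ y z := by
  simp [hermInner, add_mul, Finset.sum_add_distrib]
lemma hermInner_add_right (x y z : Fin n → K) :
    hermInner σ x (y + z) = hermInner σ x y + hermInner σ x z := by
  simp [hermInner, mul_add, Finset.sum_add_distrib]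
lemma hermInner_smul_left (c : K) (x z : Fin n → K) :
    hermInner σ (c • x) z = c * hermInner σ x z := by
  simp [hermInner, Finset.mul_sum, mul_assoc]
lemma hermInner_symm (hσσ : ∀ x, σ (σ x) = x) (x y : Fin n → K) :
    hermInner σ y x = σ (hermInner σ x y) := by
  simp [hermInner, map_sum, hσσ, mul_comm]

/-- linear functional -/
def hermL (y : Fin n → K) : (Fin n → K) →ₗ[K] K where
  toFun x := hermInner σ x y
  map_add' a b := hermInner_add_left σ a b y
  map_smul' c a := hermInner_smul_left σ c a y

lemma mem_hermDual (C : Submodule K (Fin n → K)) (y) :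
    y ∈ hermDual σ C ↔ ∀ x ∈ C, hermInner σ x y = 0 := Iff.rfl

lemma span_le_hermDual {s : Set (Fin n → K)} {y : Fin n → K} :
    y ∈ hermDual σ (Submodule.span K s) ↔ ∀ x ∈ s, hermInner σ x y = 0 := by
  rw [mem_hermDual]
  constructor
  · exact fun h x hx => h x (Submodule.subset_span hx)
  · intro h
    have : Submodule.span K s ≤ LinearMap.ker (hermL σ y) := Submodule.span_le.2 h
    exact this

lemma le_hermDual_comm (hσσ : ∀ x, σ (σ x) = x) {C D : Submodule K (Fin n → K)}
    (h : C ≤ hermDual σ D) : D ≤ hermDual σ C := by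
  intro y hy x hx
  rw [hermInner_symm σ hσσ y x, h hx y hy, map_zero]

lemma card_pow_inj {V V' : Type*} [AddCommGroup V] [Module K V] [AddCommGroup V'] [Module K V']
    [Finite V] [Finite V'] (h : Nat.card V = Nat.card V') :
    Module.finrank K V = Module.finrank K V' := by
  have : Module.Finite K V := Module.Finite.of_finite
  have : Module.Finite K V' := Module.Finite.of_finite
  rw [Module.natCard_eq_pow_finrank (K := K), Module.natCard_eq_pow_finrank (K := K) (V := V')] at h
  refine Nat.pow_right_injective ?_ h
  rw [Nat.card_eq_fintype_card]
  exact Fintype.one_lt_card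

lemma finrank_hermDual (hσσ : ∀ x, σ (σ x) = x) (C : Submodule K (Fin n → K)) :
    Module.finrank K C + Module.finrank K (hermDual σ C) = n := by
  have h1 := Subspace.finrank_add_finrank_dualAnnihilator_eq C
  rw [Module.finrank_fin_fun] at h1
  refine Eq.trans ?_ h1
  congr 1
  have : Finite (Module.Dual K (Fin n → K)) :=
    Finite.of_equiv _ (dotProductEquiv K (Fin n)).toEquiv
  refine card_pow_inj (K := K) (V := hermDual σ C) (V' := C.dualAnnihilator) ?_
  have hmem : ∀ y : Fin n → K,
      dotProductEquiv K (Fin n) (fun i => σ (y i)) ∈ C.dualAnnihilator ↔ y ∈ hermDual σ C := by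
    intro y
    rw [Submodule.mem_dualAnnihilator, mem_hermDual]
    refine forall₂_congr fun x _ => ?_
    simp [dotProduct, hermInner, mul_comm]
  refine Nat.card_eq_of_bijective (fun y => ⟨dotProductEquiv K (Fin n) (fun i => σ (y.1 i)),
    (hmem _).2 y.2⟩) ⟨?_, ?_⟩
  · intro y z h
    have h := (dotProductEquiv K (Fin n)).injective (Subtype.ext_iff.1 h)
    ext i
    exact σ.injective (congrFun h i)
  · rintro ⟨f, hf⟩
    obtain ⟨z, rfl⟩ := (dotProductEquiv K (Fin n)).surjective f
    have hz : (fun i => σ (σ (z i))) = z := funext fun i => hσσ _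
    refine ⟨⟨fun i => σ (z i), (hmem _).1 (by rw [hz]; exact hf)⟩, ?_⟩
    simp only [hz]

end herm
section iso
open Finset
variable {K : Type*} [Field K] [Fintype K]

lemma sig_sig {q : ℕ} (hK : Fintype.card K = q ^ 2) (σ : K →+* K) (hσ : ∀ x : K, σ x = x ^ q)
    (x : K) : σ (σ x) = x := by
  rw [hσ, hσ, ← pow_mul, ← sq, ← hK, FiniteField.pow_card]

lemma two_le_q {q : ℕ} (hK : Fintype.card K = q ^ 2) : 2 ≤ q := by
  have := Fintype.one_lt_card (α := K)
  rw [hK] at this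
  by_contra h
  interval_cases q <;> simp at this

lemma iso_count {q : ℕ} (hK : Fintype.card K = q ^ 2) (σ : K →+* K) (hσ : ∀ x : K, σ x = x ^ q)
    {n j : ℕ} (D : Submodule K (Fin n → K)) (hD : Module.finrank K D = j) :
    |(Nat.card {w : hermDual σ D // hermInner σ w.1 w.1 = 0} : ℝ) * q ^ (2 * j + 1)
      - (q : ℝ) ^ (2 * n)| ≤ (q : ℝ) ^ (n + 2 * j + 1) := by
  classical
  have hσσ := sig_sig hK σ hσ
  have hq2 := two_le_q hK
  have hqr : (0:ℝ) < q := by positivity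
  have hdim := finrank_hermDual σ hσσ D
  set W := hermDual σ D with hW
  have hWc : Fintype.card W = q ^ (2 * (n - j)) := by
    rw [Module.card_eq_pow_finrank (K := K), hK, ← pow_mul]
    congr 2; omega
  have hDW : Module.finrank K (hermDual σ W) = j := by
    have := finrank_hermDual σ hσσ W
    omega
  have hjn : j ≤ n := by omega
  let f : W → K := fun w => hermInner σ w.1 w.1
  let S : Finset K := univ.filter fun x : K => x ^ q + (-1) * x + 0 = 0
  have hS : S.card ≤ q := card_roots_tr q hq2 _ _
  have hfS : ∀ w, f w ∈ S := by
    intro w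
    have := hermInner_symm σ hσσ w.1 w.1
    rw [hσ] at this
    simp only [S, f, mem_filter, mem_univ, true_and]
    rw [← this]; ring
  have h0S : (0:K) ∈ S := by
    simp [S]; omega
  have hexp : ∀ w u : W, f (w + u) = f w + (hermInner σ w.1 u.1 ^ q + 1 * hermInner σ w.1 u.1 + f u) := by
    intro w u
    simp only [f, Submodule.coe_add, hermInner_add_left, hermInner_add_right]
    rw [← hσ, ← hermInner_symm σ hσσ]; ring
  have hfib : ∀ u : W, u.1 ∉ hermDual σ W →
      (∑ w : W, if f (w + u) = f w then (1:ℝ) else 0) ≤ Fintype.card W / q := by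
    intro u hu
    rw [Finset.sum_boole, le_div_iff₀ hqr]
    have hne : ∃ w : W, (hermL σ u.1).domRestrict W w ≠ 0 := by
      by_contra h
      push Not at h
      exact hu fun x hx => h ⟨x, hx⟩
    have h1 := card_preimage ((hermL σ u.1).domRestrict W) hne
      (univ.filter fun x : K => x ^ q + 1 * x + f u = 0)
    have h2 := card_roots_tr q hq2 1 (f u)
    have h3 : (univ.filter fun w : W => f (w + u) = f w)
      = (univ.filter fun w : W => (hermL σ u.1).domRestrict W w ∈
          (univ.filter fun x : K => x ^ q + 1 * x + f u = 0)) := by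
      ext w
      simp only [mem_filter, mem_univ, true_and, hexp, add_eq_left]
      rfl
    rw [h3]
    have h4 : (univ.filter fun w : W => (hermL σ u.1).domRestrict W w ∈
          (univ.filter fun x : K => x ^ q + 1 * x + f u = 0)).card * q ^ 2 ≤ q * Fintype.card W := by
      rw [← hK, h1]; exact Nat.mul_le_mul_right _ h2
    have h5 : (univ.filter fun w : W => (hermL σ u.1).domRestrict W w ∈
          (univ.filter fun x : K => x ^ q + 1 * x + f u = 0)).card * q ≤ Fintype.card W := by
      refine Nat.le_of_mul_le_mul_left (c := q) ?_ (by omega)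
      linarith
    exact_mod_cast h5
  have hrad : (((univ.filter fun u : W => u.1 ∈ hermDual σ W).card : ℕ) : ℝ) ≤ (q:ℝ) ^ (2 * j) := by
    have : (univ.filter fun u : W => u.1 ∈ hermDual σ W).card ≤ Fintype.card (hermDual σ W) := by
      rw [← Fintype.card_subtype]
      exact Fintype.card_le_of_injective (fun u => (⟨u.1.1, u.2⟩ : hermDual σ W)) (by
        intro a b h
        have h' : a.1.1 = b.1.1 := congrArg (fun z => z.1) h
        exact Subtype.ext (Subtype.ext h'))
    rw [Module.card_eq_pow_finrank (K := K), hK, ← pow_mul, hDW] at this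
    exact_mod_cast this
  have hM0 : (0:ℝ) ≤ Fintype.card W := by positivity
  have hpairs : (∑ v : W, ∑ w : W, if f v = f w then (1:ℝ) else 0) ≤
      (q:ℝ) ^ (2 * j) * Fintype.card W + (Fintype.card W : ℝ) ^ 2 / q := by
    rw [Finset.sum_comm]
    have h1 : ∀ w : W, (∑ v : W, if f v = f w then (1:ℝ) else 0)
        = ∑ u : W, if f (w + u) = f w then (1:ℝ) else 0 := fun w =>
      (Equiv.sum_comp (Equiv.addLeft w) (fun v => if f v = f w then (1:ℝ) else 0)).symm
    simp_rw [h1]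
    rw [Finset.sum_comm]
    have h2 : ∀ u : W, (∑ w : W, if f (w + u) = f w then (1:ℝ) else 0) ≤
        (if u.1 ∈ hermDual σ W then (Fintype.card W : ℝ) else 0) + Fintype.card W / q := by
      intro u
      by_cases hu : u.1 ∈ hermDual σ W
      · rw [if_pos hu, Finset.sum_boole]
        have : (((univ.filter fun w : W => f (w + u) = f w).card : ℕ) : ℝ) ≤ Fintype.card W := by
          exact_mod_cast Finset.card_le_univ _
        have : 0 ≤ (Fintype.card W : ℝ) / q := by positivity
        linarith
      · rw [if_neg hu, zero_add]; exact hfib u hu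
    refine (Finset.sum_le_sum fun u _ => h2 u).trans ?_
    rw [Finset.sum_add_distrib, ← Finset.sum_filter]
    simp only [sum_const, nsmul_eq_mul, card_univ]
    have := mul_le_mul_of_nonneg_right hrad hM0
    have h3 : (Fintype.card W : ℝ) * (Fintype.card W / q) = (Fintype.card W : ℝ) ^ 2 / q := by ring
    linarith
  have hv := variance_bound S q (by omega) hS f hfS _ hpairs 0 h0S
  have hcard : Nat.card {w : W // hermInner σ w.1 w.1 = 0} = (univ.filter fun w => f w = 0).card := by
    rw [Nat.card_eq_fintype_card, Fintype.card_subtype]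
  rw [hcard]
  set N := (univ.filter fun w => f w = 0).card
  rw [hWc] at hv
  push_cast at hv
  have e1 : (q:ℝ) ^ (2 * j) * (q:ℝ) ^ (2 * (n - j)) = ((q:ℝ) ^ n) ^ 2 := by
    rw [← pow_add, ← pow_mul]; congr 1; omega
  rw [e1] at hv
  have hv := abs_le_of_sq_le_sq hv (by positivity)
  have e2 : (N:ℝ) * q ^ (2 * j + 1) - (q : ℝ) ^ (2 * n)
      = ((N:ℝ) - (q:ℝ) ^ (2 * (n - j)) / q) * q ^ (2 * j + 1) := by
    have : (q:ℝ) ^ (2 * n) = (q:ℝ) ^ (2 * (n - j)) * (q:ℝ) ^ (2 * j) := by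
      rw [← pow_add]; congr 1; omega
    rw [this]; field_simp; ring
  rw [e2, abs_mul, abs_of_pos (show (0:ℝ) < q ^ (2 * j + 1) by positivity), add_assoc,
    pow_add (q:ℝ) n]
  exact mul_le_mul_of_nonneg_right hv (by positivity)

/-- Independent totally isotropic tuples. -/
def IsoT (σ : K →+* K) (n j : ℕ) : Type _ :=
  {s : Fin j → (Fin n → K) // LinearIndependent K s ∧ ∀ a b, hermInner σ (s a) (s b) = 0}

instance (σ : K →+* K) (n j : ℕ) : Finite (IsoT σ n j) := by unfold IsoT; infer_instance

/-- number of such -/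
def TT (σ : K →+* K) (n j : ℕ) : ℝ := (Nat.card (IsoT σ n j) : ℝ)

/-- fiber -/
def Fib (σ : K →+* K) {n j : ℕ} (s : Fin j → (Fin n → K)) : Type _ :=
  {w : Fin n → K // w ∈ hermDual σ (Submodule.span K (Set.range s)) ∧ hermInner σ w w = 0 ∧
    w ∉ Submodule.span K (Set.range s)}

instance (σ : K →+* K) {n j : ℕ} (s : Fin j → (Fin n → K)) : Finite (Fib σ s) := by
  unfold Fib; infer_instance

lemma TT_zero (σ : K →+* K) (n : ℕ) : TT σ n 0 = 1 := by
  have : Unique (IsoT σ n 0) :=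
    { default := ⟨fun a => a.elim0, linearIndependent_empty_type, fun a => a.elim0⟩
      uniq := fun s => Subtype.ext (Subsingleton.elim _ _) }
  simp [TT]

lemma TT_nonneg (σ : K →+* K) (n j : ℕ) : 0 ≤ TT σ n j := by simp [TT]

/-- extension equivalence -/
def isoEquiv (σ : K →+* K) (hσσ : ∀ x, σ (σ x) = x) (n j : ℕ) :
    IsoT σ n (j + 1) ≃ Σ s : IsoT σ n j, Fib σ s.1 where
  toFun t := ⟨⟨Fin.tail t.1, by
      have h := t.2.1
      rw [← Fin.cons_self_tail t.1, linearIndependent_finCons] at h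
      exact h.1, fun a b => t.2.2 a.succ b.succ⟩, ⟨t.1 0, by
        rw [span_le_hermDual]
        rintro _ ⟨a, rfl⟩
        exact t.2.2 a.succ 0, t.2.2 0 0, by
        have h := t.2.1
        rw [← Fin.cons_self_tail t.1, linearIndependent_finCons] at h
        exact h.2⟩⟩
  invFun p := ⟨Fin.cons p.2.1 p.1.1, linearIndependent_finCons.2 ⟨p.1.2.1, p.2.2.2.2⟩, by
    have h1 : ∀ a, hermInner σ (p.1.1 a) p.2.1 = 0 := fun a =>
      (span_le_hermDual σ).1 p.2.2.1 _ ⟨a, rfl⟩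
    intro a b
    refine Fin.cases ?_ (fun a => ?_) a <;> refine Fin.cases ?_ (fun b => ?_) b
    · simpa using p.2.2.2.1
    · simp only [Fin.cons_zero, Fin.cons_succ]
      rw [hermInner_symm σ hσσ (p.1.1 b), h1, map_zero]
    · simpa using h1 a
    · simpa using p.1.2.2 a b⟩
  left_inv t := Subtype.ext (Fin.cons_self_tail t.1)
  right_inv p := rfl

lemma fib_card (σ : K →+* K) (hσσ : ∀ x, σ (σ x) = x) {n j : ℕ} (s : IsoT σ n j) :
    (Nat.card {w : hermDual σ (Submodule.span K (Set.range s.1)) // hermInner σ w.1 w.1 = 0})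
     = Nat.card (Fib σ s.1) + Fintype.card K ^ j := by
  classical
  have hle : Submodule.span K (Set.range s.1) ≤ hermDual σ (Submodule.span K (Set.range s.1)) := by
    rw [Submodule.span_le]
    rintro _ ⟨b, rfl⟩
    rw [SetLike.mem_coe, span_le_hermDual]
    rintro _ ⟨a, rfl⟩
    exact s.2.2 a b
  have hfr : Module.finrank K (Submodule.span K (Set.range s.1)) = j := by
    simpa using finrank_span_eq_card s.2.1
  have h2 : Nat.card (Submodule.span K (Set.range s.1)) = Fintype.card K ^ j := by
    rw [Module.natCard_eq_pow_finrank (K := K), hfr, Nat.card_eq_fintype_card]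
  rw [← h2, ← Nat.card_sum]
  symm
  refine Nat.card_eq_of_bijective (Sum.elim (fun w => ⟨⟨w.1, w.2.1⟩, w.2.2.1⟩)
    (fun w => ⟨⟨w.1, hle w.2⟩, hle w.2 w.1 w.2⟩)) ⟨?_, ?_⟩
  · rintro (a | a) (b | b) h
    · exact congrArg _ (Subtype.ext (congrArg (fun z => z.1.1) h))
    · have : a.1 = b.1 := congrArg (fun z => z.1.1) h
      exact absurd (this ▸ b.2) a.2.2.2
    · have : a.1 = b.1 := congrArg (fun z => z.1.1) h
      exact absurd (this ▸ a.2) b.2.2.2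
    · exact congrArg _ (Subtype.ext (congrArg (fun z => z.1.1) h))
  · rintro ⟨⟨w, hw⟩, hw0⟩
    by_cases h : w ∈ Submodule.span K (Set.range s.1)
    · exact ⟨Sum.inr ⟨w, h⟩, rfl⟩
    · exact ⟨Sum.inl ⟨w, hw, hw0, h⟩, rfl⟩

lemma TT_succ {q : ℕ} (hK : Fintype.card K = q ^ 2) (σ : K →+* K) (hσ : ∀ x : K, σ x = x ^ q)
    (n j : ℕ) :
    |TT σ n (j + 1) * q ^ (2 * j + 1) - TT σ n j * ((q:ℝ) ^ (2 * n) - q ^ (4 * j + 1))|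
      ≤ TT σ n j * (q:ℝ) ^ (n + 2 * j + 1) := by
  have hσσ := sig_sig hK σ hσ
  have : Fintype (IsoT σ n j) := Fintype.ofFinite _
  have h1 : TT σ n (j + 1) = ∑ s : IsoT σ n j, (Nat.card (Fib σ s.1) : ℝ) := by
    rw [TT, Nat.card_congr (isoEquiv σ hσσ n j), Nat.card_sigma]
    push_cast; rfl
  have h2 : TT σ n j = ∑ s : IsoT σ n j, (1:ℝ) := by
    rw [TT, Nat.card_eq_fintype_card]; simp
  rw [h1, h2, Finset.sum_mul, Finset.sum_mul, ← Finset.sum_sub_distrib, Finset.sum_mul]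
  refine (Finset.abs_sum_le_sum_abs _ _).trans (Finset.sum_le_sum fun s _ => ?_)
  have h3 := iso_count hK σ hσ (Submodule.span K (Set.range s.1)) (j := j)
    (by simpa using finrank_span_eq_card s.2.1)
  rw [fib_card σ hσσ s, hK] at h3
  rw [one_mul, one_mul]
  refine le_of_eq_of_le ?_ h3
  congr 1
  push_cast
  ring

lemma double_count {q : ℕ} (hK : Fintype.card K = q ^ 2) (σ : K →+* K) (hσ : ∀ x : K, σ x = x ^ q)
    {n k j : ℕ} (hjk : j ≤ k) [Fintype {C : Submodule K (Fin n → K) // Module.finrank K C = k}] :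
    (∑ C : {C : Submodule K (Fin n → K) // Module.finrank K C = k},
      PP ((q:ℝ) ^ 2) j (((q:ℝ) ^ 2) ^ Module.finrank K ↥(C.1 ⊓ hermDual σ C.1)))
      * PP ((q:ℝ) ^ 2) (k - j) (((q:ℝ) ^ 2) ^ (k - j))
      = TT σ n j * PP ((q:ℝ) ^ 2) (k - j) (((q:ℝ) ^ 2) ^ (n - j - j)) := by
  classical
  have hσσ := sig_sig hK σ hσ
  have hKr : ((q:ℝ) ^ 2) = (Fintype.card K : ℝ) := by rw [hK]; push_cast; rfl
  have : Fintype (IsoT σ n j) := Fintype.ofFinite _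
  rw [hKr]
  simp_rw [← card_indep_in]
  let B : IsoT σ n j → Type _ := fun s => {C : Submodule K (Fin n → K) // Module.finrank K C = k ∧
      Submodule.span K (Set.range s.1) ≤ C ∧ C ≤ hermDual σ (Submodule.span K (Set.range s.1))}
  let e : (Σ C : {C : Submodule K (Fin n → K) // Module.finrank K C = k},
      {s : Fin j → (Fin n → K) // LinearIndependent K s ∧ ∀ a, s a ∈ C.1 ⊓ hermDual σ C.1}) ≃
      Σ s : IsoT σ n j, B s :=
    { toFun := fun p => ⟨⟨p.2.1, p.2.2.1, fun a b => (p.2.2.2 b).2 _ (p.2.2.2 a).1⟩,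
        ⟨p.1.1, p.1.2, by
          rw [Submodule.span_le]; rintro _ ⟨a, rfl⟩; exact (p.2.2.2 a).1, by
          apply le_hermDual_comm σ hσσ
          rw [Submodule.span_le]; rintro _ ⟨a, rfl⟩; exact (p.2.2.2 a).2⟩⟩
      invFun := fun p => ⟨⟨p.2.1, p.2.2.1⟩, ⟨p.1.1, p.1.2.1, fun a =>
        ⟨p.2.2.2.1 (Submodule.subset_span ⟨a, rfl⟩),
         le_hermDual_comm σ hσσ p.2.2.2.2 (Submodule.subset_span ⟨a, rfl⟩)⟩⟩⟩
      left_inv := fun p => rfl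
      right_inv := fun p => rfl }
  have hB : ∀ s, Finite (B s) := fun s => by simp only [B]; infer_instance
  have h1 := Nat.card_congr e
  rw [Nat.card_sigma, Nat.card_sigma] at h1
  have h2 : (∑ C : {C : Submodule K (Fin n → K) // Module.finrank K C = k},
      (Nat.card {s : Fin j → (Fin n → K) // LinearIndependent K s ∧ ∀ a, s a ∈ C.1 ⊓ hermDual σ C.1} : ℝ))
      = ∑ s : IsoT σ n j, (Nat.card (B s) : ℝ) := by exact_mod_cast h1
  rw [h2, Finset.sum_mul, TT, Nat.card_eq_fintype_card, ← Finset.card_univ (α := IsoT σ n j), ← nsmul_eq_mul,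
    ← Finset.sum_const]
  refine Finset.sum_congr rfl fun s _ => ?_
  have hfr : Module.finrank K (Submodule.span K (Set.range s.1)) = j := by
    simpa using finrank_span_eq_card s.2.1
  have hdim := finrank_hermDual σ hσσ (Submodule.span K (Set.range s.1))
  refine card_between hjk _ _ ?_ hfr (by omega)
  rw [Submodule.span_le]
  rintro _ ⟨b, rfl⟩
  rw [SetLike.mem_coe, span_le_hermDual]
  rintro _ ⟨a, rfl⟩
  exact s.2.2 a b

end iso
section ana
open Finset Filter Topology

/-- partial products -/
def ee (Q : ℝ) (m : ℕ) : ℝ := ∏ i ∈ range m, (1 - Q⁻¹ ^ (i + 1))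

lemma fac_pos {Q : ℝ} (hQ : 1 < Q) (i : ℕ) : 0 < 1 - Q⁻¹ ^ (i + 1) := by
  have := pow_lt_one₀ (a := Q⁻¹) (by positivity) (inv_lt_one_of_one_lt₀ hQ) (n := i + 1) (by omega)
  linarith

lemma ee_pos {Q : ℝ} (hQ : 1 < Q) (m : ℕ) : 0 < ee Q m := prod_pos fun i _ => fac_pos hQ i

lemma ee_le_one {Q : ℝ} (hQ : 1 < Q) (m : ℕ) : ee Q m ≤ 1 :=
  prod_le_one (fun i _ => (fac_pos hQ i).le) fun i _ => by
    have : 0 ≤ Q⁻¹ ^ (i + 1) := by positivity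
    linarith

lemma summable_geo {Q : ℝ} (hQ : 1 < Q) : Summable fun i : ℕ => Q⁻¹ ^ (i + 1) :=
  (summable_nat_add_iff 1).2 (summable_geometric_of_lt_one (by positivity) (inv_lt_one_of_one_lt₀ hQ))

lemma multipliable_fac {Q : ℝ} (hQ : 1 < Q) : Multipliable fun i : ℕ => 1 - Q⁻¹ ^ (i + 1) := by
  have := Real.multipliable_one_add_of_summable (summable_geo hQ).neg
  simpa [sub_eq_add_neg] using this

lemma ginfty_ne {Q : ℝ} (hQ : 1 < Q) : ginfty Q ≠ 0 := by
  have := tprod_one_add_ne_zero_of_summable (f := fun i : ℕ => -Q⁻¹ ^ (i + 1))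
    (fun i => by have := fac_pos hQ i; rw [← sub_eq_add_neg]; exact this.ne')
    (by simpa using (summable_geo hQ).norm)
  simpa [sub_eq_add_neg, ginfty] using this

lemma ee_tendsto {Q : ℝ} (hQ : 1 < Q) : Tendsto (ee Q) atTop (𝓝 (ginfty Q)) :=
  (multipliable_fac hQ).hasProd.tendsto_prod_nat

lemma ee_antitone {Q : ℝ} (hQ : 1 < Q) : Antitone (ee Q) := by
  refine antitone_nat_of_succ_le fun m => ?_
  rw [ee, prod_range_succ]
  refine mul_le_of_le_one_right (ee_pos hQ m).le ?_
  have : 0 ≤ Q⁻¹ ^ (m + 1) := by positivity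
  linarith

lemma ginfty_le_ee {Q : ℝ} (hQ : 1 < Q) (m : ℕ) : ginfty Q ≤ ee Q m :=
  (ee_antitone hQ).le_of_tendsto (ee_tendsto hQ) m

lemma ginfty_pos {Q : ℝ} (hQ : 1 < Q) : 0 < ginfty Q :=
  lt_of_le_of_ne (ge_of_tendsto' (ee_tendsto hQ) fun m => (ee_pos hQ m).le) (ginfty_ne hQ).symm

lemma PP_ee {Q : ℝ} (hQ : 1 < Q) (m k : ℕ) :
    PP Q k (Q ^ (m + k)) * ee Q m = Q ^ ((m + k) * k) * ee Q (m + k) := by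
  induction k with
  | zero => simp [PP]
  | succ k ih =>
    have h0 : Q ≠ 0 := by positivity
    have h1 : PP Q (k + 1) (Q ^ (m + (k + 1))) =
        (Q ^ (m + k + 1) - 1) * (Q ^ k * PP Q k (Q ^ (m + k))) := by
      have h2 : Q ^ k * PP Q k (Q ^ (m + k)) = ∏ i ∈ range k, (Q * (Q ^ (m + k) - Q ^ i)) := by
        rw [prod_mul_distrib, prod_const, card_range, PP]
      rw [h2, PP, prod_range_succ', mul_comm, pow_zero, ← add_assoc]
      congr 1
      exact prod_congr rfl fun i _ => by ring
    have h2 : ee Q (m + (k + 1)) = ee Q (m + k) * (1 - Q⁻¹ ^ (m + k + 1)) := by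
      rw [ee, ← add_assoc, prod_range_succ, ee]
    rw [h1, h2, mul_assoc, mul_assoc, ih, inv_pow]
    have : Q ^ ((m + (k + 1)) * (k + 1)) = Q ^ (m + k + 1) * Q ^ k * Q ^ ((m + k) * k) := by ring
    rw [this]
    field_simp

lemma PP_ee' {Q : ℝ} (hQ : 1 < Q) (k : ℕ) : PP Q k (Q ^ k) = Q ^ (k * k) * ee Q k := by
  have := PP_ee hQ 0 k
  simpa [ee] using this

lemma gauss_PP {Q : ℝ} (hQ : 1 < Q) (m k : ℕ) :
    gaussBinom Q (m + k) k = PP Q k (Q ^ (m + k)) / PP Q k (Q ^ k) := by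
  rw [gaussBinom, PP, PP, ← prod_div_distrib]
  refine prod_congr rfl fun i hi => ?_
  have hi : i < k := mem_range.1 hi
  obtain ⟨d, rfl⟩ := Nat.exists_eq_add_of_lt hi
  have h0 : Q ≠ 0 := by positivity
  have e1 : m + (i + d + 1) - i = m + d + 1 := by omega
  have e2 : i + d + 1 - i = d + 1 := by omega
  rw [e1, e2]
  have h3 : Q ^ (m + (i + d + 1)) - Q ^ i = Q ^ i * (Q ^ (m + d + 1) - 1) := by ring
  have h4 : Q ^ (i + d + 1) - Q ^ i = Q ^ i * (Q ^ (d + 1) - 1) := by ring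
  rw [h3, h4, mul_div_mul_left _ _ (by positivity)]

lemma gauss_ee {Q : ℝ} (hQ : 1 < Q) (m k : ℕ) :
    gaussBinom Q (m + k) k = Q ^ (m * k) * ee Q (m + k) / (ee Q m * ee Q k) := by
  have h0 : Q ≠ 0 := by positivity
  have h1 := PP_ee hQ m k
  have hm := (ee_pos hQ m).ne'
  have hk := (ee_pos hQ k).ne'
  rw [gauss_PP hQ, PP_ee' hQ, eq_div_of_mul_eq hm h1]
  field_simp
  ring

lemma hpoly_ee {q : ℝ} (hq : 1 < q) (m : ℕ) :
    hpoly (q ^ 2) m = q ^ (m * (m + 1)) * ee (q ^ 2) m := by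
  induction m with
  | zero => simp [hpoly, ee]
  | succ m ih =>
    rw [hpoly, prod_Icc_succ_top (by omega), ee, prod_range_succ, ← ee, ← hpoly, ih]
    have h0 : q ≠ 0 := by positivity
    have : q ^ ((m + 1) * (m + 1 + 1)) = q ^ (m * (m + 1)) * (q ^ 2) ^ (m + 1) := by ring
    rw [this, inv_pow]
    field_simp

/-- Lagrange coefficients -/
def cc (Q : ℝ) (l m : ℕ) : ℝ :=
  1 / (PP Q l (Q ^ l) * ∏ s ∈ range m, (Q ^ l - Q ^ (l + s + 1)))

lemma pw_ne {Q : ℝ} (hQ : 1 < Q) {a b : ℕ} (h : a ≠ b) : Q ^ a - Q ^ b ≠ 0 := by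
  rw [sub_ne_zero]
  exact fun e => h (pow_right_injective₀ (by positivity) hQ.ne' e)

lemma lagr {Q : ℝ} (hQ : 1 < Q) (l M : ℕ) (x : ℝ) :
    ∑ m ∈ range (M + 1), cc Q l m * PP Q (l + m) x =
      PP Q l x * (∏ s ∈ range M, (x - Q ^ (l + s + 1))) /
        (PP Q l (Q ^ l) * ∏ s ∈ range M, (Q ^ l - Q ^ (l + s + 1))) := by
  induction M with
  | zero => simp [cc]; ring
  | succ M ih =>
    have h1 : PP Q (l + (M + 1)) x = PP Q l x * (x - Q ^ l) * ∏ s ∈ range M, (x - Q ^ (l + s + 1)) := by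
      rw [PP, prod_range_add, prod_range_succ', ← PP]
      simp only [add_zero, add_assoc]; ring
    rw [sum_range_succ, ih, h1, cc, prod_range_succ, prod_range_succ]
    have hA : PP Q l (Q ^ l) ≠ 0 := (PP_pos hQ le_rfl).ne'
    have hB : ∏ s ∈ range M, (Q ^ l - Q ^ (l + s + 1)) ≠ 0 :=
      prod_ne_zero_iff.2 fun s _ => pw_ne hQ (by omega)
    have hC : Q ^ l - Q ^ (l + M + 1) ≠ 0 := pw_ne hQ (by omega)
    field_simp
    ring

lemma lagr_delta {Q : ℝ} (hQ : 1 < Q) (l M h : ℕ) (hM : h ≤ l + M) :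
    ∑ m ∈ range (M + 1), cc Q l m * PP Q (l + m) (Q ^ h) = if h = l then 1 else 0 := by
  rw [lagr hQ]
  split_ifs with e
  · subst e
    refine div_self (mul_ne_zero (PP_pos hQ le_rfl).ne' ?_)
    exact prod_ne_zero_iff.2 fun s _ => pw_ne hQ (by omega)
  · rcases lt_or_gt_of_ne e with e | e
    · rw [PP_eq_zero Q e]; simp
    · rw [prod_eq_zero (i := h - l - 1) (mem_range.2 (by omega))]
      · simp
      · rw [show l + (h - l - 1) + 1 = h by omega, sub_self]

lemma cc_eq {q : ℝ} (hq : 1 < q) (l m : ℕ) :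
    cc (q ^ 2) l m * q ^ ((l + m) ^ 2)
      = q ^ l / hpoly (q ^ 2) l * ((-q⁻¹) ^ m / ee (q ^ 2) m) := by
  have h0 : q ≠ 0 := by positivity
  have hQ : 1 < q ^ 2 := one_lt_pow₀ hq (by norm_num)
  have h1 : ∏ s ∈ range m, ((q ^ 2) ^ l - (q ^ 2) ^ (l + s + 1))
      = (-1) ^ m * q ^ (2 * l * m) * hpoly (q ^ 2) m := by
    have : hpoly (q ^ 2) m = ∏ s ∈ range m, ((q ^ 2) ^ (s + 1) - 1) := by
      rw [hpoly, ← Finset.Ico_add_one_right_eq_Icc, prod_Ico_eq_prod_range]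
      simp [add_comm]
    have h2 : (-1 : ℝ) ^ m * q ^ (2 * l * m) = ∏ s ∈ range m, ((-1) * q ^ (2 * l)) := by
      rw [prod_const, card_range, mul_pow, ← pow_mul]
    rw [this, h2, ← prod_mul_distrib]
    exact prod_congr rfl fun i _ => by ring
  rw [cc, h1, PP_ee' hQ, hpoly_ee hq, hpoly_ee hq]
  have hl := (ee_pos hQ l).ne'
  have hm := (ee_pos hQ m).ne'
  have h2 : (-q⁻¹) ^ m = (-1) ^ m / q ^ m := by
    rw [neg_eq_neg_one_mul, mul_pow, inv_pow]; rfl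
  rw [h2]
  have h3 : ((-1 : ℝ) ^ m) * (-1) ^ m = 1 := by rw [← mul_pow]; simp
  have h4 : ((-1 : ℝ) ^ m) ≠ 0 := by positivity
  field_simp
  have h5 : ((-1 : ℝ) ^ m) ^ 2 = 1 := by rw [sq, h3]
  rw [h5]
  ring

lemma euler_sum {q : ℝ} (hq : 1 < q) :
    Summable (fun m : ℕ => (-q⁻¹) ^ m / ee (q ^ 2) m) ∧
    (∑' m : ℕ, (-q⁻¹) ^ m / ee (q ^ 2) m) * (∏' i : ℕ, (1 + q⁻¹ * (q ^ 2)⁻¹ ^ i)) = 1 := by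
  have hQ : 1 < q ^ 2 := one_lt_pow₀ hq (by norm_num)
  set x := (q ^ 2)⁻¹ with hx
  have hx0 : 0 < x := by positivity
  have hx1 : x < 1 := inv_lt_one_of_one_lt₀ hQ
  have hg := ginfty_pos hQ
  have hsum : ∀ z : ℝ, |z| < 1 → Summable (fun m : ℕ => z ^ m / ee (q ^ 2) m) := by
    intro z hz
    refine Summable.of_norm_bounded (g := fun m : ℕ => |z| ^ m / ginfty (q ^ 2))
      ((summable_geometric_of_lt_one (abs_nonneg _) hz).div_const _) fun m => ?_
    rw [norm_div, norm_pow, Real.norm_eq_abs, Real.norm_eq_abs, abs_of_pos (ee_pos hQ m)]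
    gcongr
    exact ginfty_le_ee hQ m
  set F : ℝ → ℝ := fun z => ∑' m : ℕ, z ^ m / ee (q ^ 2) m with hF
  have hfun : ∀ z : ℝ, |z| < 1 → F (z * x) = (1 - z) * F z := by
    intro z hz
    have hzx : |z * x| < 1 := by
      rw [abs_mul, abs_of_pos hx0]; nlinarith [abs_nonneg z]
    have s1 := hsum z hz
    have s2 := hsum _ hzx
    have key : F z - F (z * x) = z * F z := by
      simp only [hF]
      rw [← s1.tsum_sub s2, (s1.sub s2).tsum_eq_zero_add, ← tsum_mul_left]
      simp only [pow_zero, sub_self, zero_add]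
      refine tsum_congr fun m => ?_
      have h2 : ee (q ^ 2) (m + 1) = ee (q ^ 2) m * (1 - x ^ (m + 1)) := by
        rw [ee, prod_range_succ, ee]
      have h3 := (ee_pos hQ m).ne'
      have h4 : 1 - x ^ (m + 1) ≠ 0 := (fac_pos hQ m).ne'
      rw [h2, mul_pow]
      field_simp
      ring
    linarith
  have hz : |(-q⁻¹)| < 1 := by
    rw [abs_neg, abs_of_pos (by positivity)]; exact inv_lt_one_of_one_lt₀ hq
  refine ⟨hsum _ hz, ?_⟩
  have hiter : ∀ N : ℕ, F (-q⁻¹ * x ^ N) = F (-q⁻¹) * ∏ i ∈ range N, (1 + q⁻¹ * x ^ i) := by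
    intro N
    induction N with
    | zero => simp
    | succ N ih =>
      have : |(-q⁻¹ * x ^ N)| < 1 := by
        rw [abs_mul, abs_of_pos (pow_pos hx0 N)]
        have := pow_le_one₀ hx0.le hx1.le (n := N)
        nlinarith [abs_nonneg (-q⁻¹), pow_pos hx0 N]
      rw [pow_succ, ← mul_assoc, hfun _ this, ih, prod_range_succ]
      ring
  have hmul : Multipliable fun i : ℕ => 1 + q⁻¹ * x ^ i :=
    Real.multipliable_one_add_of_summable
      ((summable_geometric_of_lt_one hx0.le hx1).mul_left _)
  have hlim1 : Tendsto (fun N : ℕ => F (-q⁻¹ * x ^ N)) atTop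
      (𝓝 (F (-q⁻¹) * ∏' i : ℕ, (1 + q⁻¹ * x ^ i))) := by
    simp_rw [hiter]
    exact hmul.hasProd.tendsto_prod_nat.const_mul _
  have hlim2 : Tendsto (fun N : ℕ => F (-q⁻¹ * x ^ N)) atTop
      (𝓝 (∑' m : ℕ, if m = 0 then (1:ℝ) else 0)) := by
    refine tendsto_tsum_of_dominated_convergence (bound := fun m => |(-q⁻¹)| ^ m / ee (q ^ 2) m)
      ?_ ?_ ?_
    · refine hsum _ (by rwa [abs_abs])
    · intro m
      rcases m with _ | m
      · simp [ee]
      · simp only [Nat.succ_ne_zero, if_false]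
        have : Tendsto (fun N : ℕ => -q⁻¹ * x ^ N) atTop (𝓝 0) := by
          simpa using (tendsto_pow_atTop_nhds_zero_of_lt_one hx0.le hx1).const_mul (-q⁻¹)
        simpa using (this.pow (m + 1)).div_const (ee (q ^ 2) (m + 1))
    · refine Eventually.of_forall fun N m => ?_
      rw [norm_div, norm_pow, Real.norm_eq_abs, Real.norm_eq_abs, abs_of_pos (ee_pos hQ m)]
      have := (ee_pos hQ m).le
      refine div_le_div_of_nonneg_right (pow_le_pow_left₀ (abs_nonneg _) ?_ m) this
      rw [abs_mul, abs_of_pos (pow_pos hx0 N)]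
      exact mul_le_of_le_one_right (abs_nonneg _) (pow_le_one₀ hx0.le hx1.le)
  have := tendsto_nhds_unique hlim1 hlim2
  rw [this]
  simp

lemma prod_id {q : ℝ} (hq : 1 < q) :
    (∏' i : ℕ, (1 + q⁻¹ * (q ^ 2)⁻¹ ^ i)) * (ginfty q * ginfty (q ^ 4))
      = ginfty (q ^ 2) * ginfty (q ^ 2) := by
  have hQ : 1 < q ^ 2 := one_lt_pow₀ hq (by norm_num)
  have hQ4 : 1 < q ^ 4 := one_lt_pow₀ hq (by norm_num)
  have hs : Summable fun i : ℕ => q⁻¹ * (q ^ 2)⁻¹ ^ i :=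
    (summable_geometric_of_lt_one (by positivity) (inv_lt_one_of_one_lt₀ hQ)).mul_left _
  have hplus : Multipliable fun i : ℕ => 1 + q⁻¹ * (q ^ 2)⁻¹ ^ i :=
    Real.multipliable_one_add_of_summable hs
  have hminus : Multipliable fun i : ℕ => 1 - q⁻¹ * (q ^ 2)⁻¹ ^ i := by
    simpa [sub_eq_add_neg] using Real.multipliable_one_add_of_summable hs.neg
  have h0 : q ≠ 0 := by positivity
  have split : ∀ r : ℝ, 1 < r → (Multipliable fun i : ℕ => 1 - r⁻¹ * (r ^ 2)⁻¹ ^ i) →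
      ginfty r = (∏' i : ℕ, (1 - r⁻¹ * (r ^ 2)⁻¹ ^ i)) * ginfty (r ^ 2) := by
    intro r hr hm
    have e1 : ∀ k : ℕ, 1 - r⁻¹ ^ (2 * k + 1) = 1 - r⁻¹ * (r ^ 2)⁻¹ ^ k := by
      intro k; rw [pow_succ, pow_mul, inv_pow]; ring
    have e2 : ∀ k : ℕ, 1 - r⁻¹ ^ (2 * k + 1 + 1) = 1 - (r ^ 2)⁻¹ ^ (k + 1) := by
      intro k; rw [← inv_pow r 2, ← pow_mul]; ring
    rw [ginfty, ← tprod_even_mul_odd]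
    · simp_rw [e1, e2]; rfl
    · simp_rw [e1]; exact hm
    · simp_rw [e2]; exact multipliable_fac (one_lt_pow₀ hr (by norm_num))
  have e3 : ∀ i : ℕ, 1 - (q ^ 2)⁻¹ * ((q ^ 2) ^ 2)⁻¹ ^ i
      = (1 + q⁻¹ * (q ^ 2)⁻¹ ^ i) * (1 - q⁻¹ * (q ^ 2)⁻¹ ^ i) := by
    intro i
    have : ((q ^ 2) ^ 2)⁻¹ ^ i = ((q ^ 2)⁻¹ ^ i) * ((q ^ 2)⁻¹ ^ i) := by
      rw [← mul_pow]; congr 1; field_simp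
    rw [this, ← inv_pow q 2]; ring
  have s1 := split q hq hminus
  have s2 := split (q ^ 2) hQ (by simp_rw [e3]; exact hplus.mul hminus)
  simp_rw [e3] at s2
  rw [hplus.tprod_mul hminus] at s2
  have : (q ^ 2) ^ 2 = q ^ 4 := by ring
  rw [this] at s2
  rw [s1]
  linear_combination (-ginfty (q ^ 2)) * s2

end ana
section assemble
open Finset Filter Topology
variable {K : Type*} [Field K] [Fintype K]

/-- normalized isotropic count -/
def uu (σ : K →+* K) (q : ℕ) (n j : ℕ) : ℝ := TT σ n j * (q:ℝ) ^ (j ^ 2) / (q:ℝ) ^ (2 * n * j)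

lemma uu_nonneg (σ : K →+* K) (q : ℕ) (n j : ℕ) : 0 ≤ uu σ q n j := by
  have := TT_nonneg σ n j
  unfold uu; positivity

lemma uu_zero (σ : K →+* K) (q : ℕ) (n : ℕ) : uu σ q n 0 = 1 := by
  simp [uu, TT_zero]

lemma uu_succ {q : ℕ} (hK : Fintype.card K = q ^ 2) (σ : K →+* K) (hσ : ∀ x : K, σ x = x ^ q)
    (n j : ℕ) :
    |uu σ q n (j + 1) - uu σ q n j * (1 - (q:ℝ) ^ (4 * j + 1) / (q:ℝ) ^ (2 * n))|
      ≤ uu σ q n j * ((q:ℝ) ^ (2 * j + 1) / (q:ℝ) ^ n) := by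
  have hq2 := two_le_q hK
  have hq0 : (0:ℝ) < q := by positivity
  have h := TT_succ hK σ hσ n j
  have e1 : uu σ q n (j + 1) - uu σ q n j * (1 - (q:ℝ) ^ (4 * j + 1) / (q:ℝ) ^ (2 * n))
      = ((q:ℝ) ^ (j ^ 2) / (q:ℝ) ^ (2 * n * j + 2 * n)) *
      (TT σ n (j + 1) * q ^ (2 * j + 1) - TT σ n j * ((q:ℝ) ^ (2 * n) - q ^ (4 * j + 1))) := by
    unfold uu
    rw [show (j + 1) ^ 2 = j ^ 2 + (2 * j + 1) by ring,
      show 2 * n * (j + 1) = 2 * n * j + 2 * n by ring, pow_add, pow_add]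
    field_simp
    ring
  have e2 : uu σ q n j * ((q:ℝ) ^ (2 * j + 1) / (q:ℝ) ^ n)
      = ((q:ℝ) ^ (j ^ 2) / (q:ℝ) ^ (2 * n * j + 2 * n)) *
      (TT σ n j * (q:ℝ) ^ (n + 2 * j + 1)) := by
    unfold uu
    rw [show 2 * n * j + 2 * n = 2 * n * j + (n + n) by ring, pow_add, pow_add,
      show n + 2 * j + 1 = n + (2 * j + 1) by ring, pow_add (q:ℝ) n (2 * j + 1)]
    field_simp
    ring
  have hp : (0:ℝ) < (q:ℝ) ^ (j ^ 2) / (q:ℝ) ^ (2 * n * j + 2 * n) := by positivity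
  rw [e1, e2, abs_mul, abs_of_pos hp]
  exact mul_le_mul_of_nonneg_left h hp.le

lemma uu_bound {q : ℕ} (hK : Fintype.card K = q ^ 2) (σ : K →+* K) (hσ : ∀ x : K, σ x = x ^ q)
    (n j : ℕ) (hj : 2 * j ≤ n) : uu σ q n j ≤ Real.exp ((q:ℝ)⁻¹ ^ (n - 2 * j)) := by
  have hq2 := two_le_q hK
  have hq2r : (2:ℝ) ≤ q := by exact_mod_cast hq2
  have hq0 : (0:ℝ) < q := by positivity
  induction j with
  | zero => rw [uu_zero]; exact Real.one_le_exp (by positivity)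
  | succ j ih =>
    have ih := ih (by omega)
    obtain ⟨d, rfl⟩ : ∃ d, n = 2 * (j + 1) + d := ⟨n - 2 * (j + 1), by omega⟩
    set n := 2 * (j + 1) + d with hn
    have h := (abs_le.1 (uu_succ hK σ hσ n j)).2
    have hu := uu_nonneg σ q n j
    have h1 : 0 ≤ uu σ q n j * ((q:ℝ) ^ (4 * j + 1) / (q:ℝ) ^ (2 * n)) := by positivity
    have h2 : uu σ q n (j + 1) ≤ uu σ q n j * (1 + (q:ℝ) ^ (2 * j + 1) / (q:ℝ) ^ n) := by
      linarith
    have e1 : n - 2 * j = d + 2 := by omega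
    have e2 : n - 2 * (j + 1) = d := by omega
    rw [e1] at ih
    rw [e2]
    have e3 : (q:ℝ) ^ (2 * j + 1) / (q:ℝ) ^ n = q * (q:ℝ)⁻¹ ^ (d + 2) := by
      rw [hn, show 2 * (j + 1) + d = 2 * j + (d + 2) by ring, pow_add (q:ℝ) (2 * j) (d + 2),
        pow_succ, inv_pow]
      field_simp
    rw [e3] at h2
    set y := (q:ℝ)⁻¹ ^ (d + 2) with hy
    have hy0 : 0 < y := by positivity
    have e4 : (q:ℝ)⁻¹ ^ d = q ^ 2 * y := by
      rw [hy, pow_add, inv_pow, inv_pow]; field_simp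
    rw [e4]
    have h3 : 1 + q * y ≤ Real.exp (q * y) := by linarith [Real.add_one_le_exp (q * y)]
    calc uu σ q n (j + 1) ≤ uu σ q n j * (1 + q * y) := h2
      _ ≤ Real.exp y * Real.exp (q * y) := by gcongr
      _ = Real.exp (y + q * y) := by rw [Real.exp_add]
      _ ≤ _ := by
        apply Real.exp_le_exp.2
        have : (1:ℝ) + q ≤ q ^ 2 := by nlinarith
        nlinarith

lemma uu_le {q : ℕ} (hK : Fintype.card K = q ^ 2) (σ : K →+* K) (hσ : ∀ x : K, σ x = x ^ q)
    (n j : ℕ) (hj : 2 * j ≤ n) : uu σ q n j ≤ Real.exp 1 := by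
  refine (uu_bound hK σ hσ n j hj).trans (Real.exp_le_exp.2 (pow_le_one₀ (by positivity) ?_))
  have hq2r : (2:ℝ) ≤ q := by exact_mod_cast two_le_q hK
  exact inv_le_one_of_one_le₀ (by linarith)

lemma uu_tendsto {q : ℕ} (hK : Fintype.card K = q ^ 2) (σ : K →+* K) (hσ : ∀ x : K, σ x = x ^ q)
    (j : ℕ) : Tendsto (fun n => uu σ q n j) atTop (𝓝 1) := by
  have hq2r : (2:ℝ) ≤ q := by exact_mod_cast two_le_q hK
  have hdiv : ∀ c : ℝ, Tendsto (fun n : ℕ => c / (q:ℝ) ^ n) atTop (𝓝 0) := fun c =>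
    tendsto_const_nhds.div_atTop (tendsto_pow_atTop_atTop_of_one_lt (by linarith))
  have hdiv2 : ∀ c : ℝ, Tendsto (fun n : ℕ => c / (q:ℝ) ^ (2 * n)) atTop (𝓝 0) := fun c =>
    (hdiv c).comp (tendsto_id.const_mul_atTop' (by norm_num : 0 < 2))
  induction j with
  | zero => simp_rw [uu_zero]; exact tendsto_const_nhds
  | succ j ih =>
    have h1 : Tendsto (fun n => uu σ q n j * (1 - (q:ℝ) ^ (4 * j + 1) / (q:ℝ) ^ (2 * n)))
        atTop (𝓝 1) := by
      simpa using ih.mul ((hdiv2 ((q:ℝ) ^ (4 * j + 1))).const_sub 1)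
    have h2 : Tendsto (fun n => uu σ q n j * ((q:ℝ) ^ (2 * j + 1) / (q:ℝ) ^ n)) atTop (𝓝 0) := by
      simpa using ih.mul (hdiv ((q:ℝ) ^ (2 * j + 1)))
    have h3 := squeeze_zero_norm (f := fun n => uu σ q n (j+1) -
      uu σ q n j * (1 - (q:ℝ) ^ (4 * j + 1) / (q:ℝ) ^ (2 * n)))
      (fun n => by rw [Real.norm_eq_abs]; exact uu_succ hK σ hσ n j) h2
    simpa using h3.add h1

/-- hull moments -/
def SS (σ : K →+* K) (q n k j : ℕ) : ℝ :=
  letI : Fintype {C : Submodule K (Fin n → K) // Module.finrank K C = k} := Fintype.ofFinite _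
  ∑ C : {C : Submodule K (Fin n → K) // Module.finrank K C = k},
      PP ((q:ℝ) ^ 2) j (((q:ℝ) ^ 2) ^ Module.finrank K ↥(C.1 ⊓ hermDual σ C.1))

lemma SS_zero {q : ℕ} (hK : Fintype.card K = q ^ 2) (σ : K →+* K) (hσ : ∀ x : K, σ x = x ^ q)
    {m k j : ℕ} (h : k < j ∨ m < j) : SS σ q (m + k) k j = 0 := by
  refine Finset.sum_eq_zero fun C _ => PP_eq_zero _ ?_
  have h1 := finrank_hermDual σ (sig_sig hK σ hσ) C.1
  rw [C.2] at h1
  have h2 : Module.finrank K ↥(C.1 ⊓ hermDual σ C.1) ≤ Module.finrank K C.1 :=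
    Submodule.finrank_mono inf_le_left
  have h3 : Module.finrank K ↥(C.1 ⊓ hermDual σ C.1) ≤ Module.finrank K (hermDual σ C.1) :=
    Submodule.finrank_mono inf_le_right
  rw [C.2] at h2
  omega

/-- normalized moments -/
def rho (σ : K →+* K) (q : ℕ) (j : ℕ) (p : ℕ × ℕ) : ℝ :=
  SS σ q (p.2 + p.1) p.1 j / (gaussBinom ((q:ℝ) ^ 2) (p.2 + p.1) p.1 * (q:ℝ) ^ (j ^ 2))

lemma rho_eq {q : ℕ} (hK : Fintype.card K = q ^ 2) (σ : K →+* K) (hσ : ∀ x : K, σ x = x ^ q)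
    {m k j : ℕ} (hk : j ≤ k) (hm : j ≤ m) :
    rho σ q j (k, m) = uu σ q (m + k) j * ((ee ((q:ℝ) ^ 2) (m - j + (k - j)) * ee ((q:ℝ) ^ 2) m
      * ee ((q:ℝ) ^ 2) k) / (ee ((q:ℝ) ^ 2) (m - j) * ee ((q:ℝ) ^ 2) (k - j)
        * ee ((q:ℝ) ^ 2) (m + k))) := by
  have hq2r : (2:ℝ) ≤ q := by exact_mod_cast two_le_q hK
  have hq0 : (q:ℝ) ≠ 0 := by positivity
  have hQ : (1:ℝ) < (q:ℝ) ^ 2 := by nlinarith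
  letI : Fintype {C : Submodule K (Fin (m + k) → K) // Module.finrank K C = k} := Fintype.ofFinite _
  have h := double_count hK σ hσ (n := m + k) hk
  have h' : SS σ q (m + k) k j * PP ((q:ℝ) ^ 2) (k - j) (((q:ℝ) ^ 2) ^ (k - j))
      = TT σ (m + k) j * PP ((q:ℝ) ^ 2) (k - j) (((q:ℝ) ^ 2) ^ (m + k - j - j)) := h
  clear h
  obtain ⟨k', rfl⟩ := Nat.exists_eq_add_of_le hk
  obtain ⟨m', rfl⟩ := Nat.exists_eq_add_of_le hm
  rw [rho]
  simp only
  set n := j + m' + (j + k') with hn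
  have e1 : n - j - j = m' + k' := by omega
  rw [e1] at h'
  simp only [Nat.add_sub_cancel_left] at h' ⊢
  have p := fun i => (ee_pos hQ i).ne'
  have hS : SS σ q n (j + k') j = TT σ n j * (((q:ℝ) ^ 2) ^ (m' * k') * ee ((q:ℝ) ^ 2) (m' + k')
      / (ee ((q:ℝ) ^ 2) m' * ee ((q:ℝ) ^ 2) k')) := by
    rw [← gauss_ee hQ, gauss_PP hQ, ← mul_div_assoc]
    exact eq_div_of_mul_eq (PP_pos hQ le_rfl).ne' h'
  rw [hS, hn, gauss_ee hQ, ← hn, uu]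
  have p1 := p (m' + k'); have p2 := p m'; have p3 := p k'; have p4 := p n
  have p5 := p (j + m'); have p6 := p (j + k')
  have e3 : (q:ℝ) ^ (2 * n * j) * ((q:ℝ) ^ 2) ^ (m' * k')
      = (q:ℝ) ^ (j ^ 2) * ((q:ℝ) ^ (j ^ 2) * ((q:ℝ) ^ 2) ^ ((j + m') * (j + k'))) := by
    rw [← pow_mul, ← pow_mul, ← pow_add, ← pow_add, ← pow_add]
    congr 1
    rw [hn]; ring
  have hB : ((q:ℝ) ^ 2) ^ ((j + m') * (j + k')) ≠ 0 := by positivity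
  have hD : (q:ℝ) ^ (2 * n * j) ≠ 0 := by positivity
  have hP : (q:ℝ) ^ (j ^ 2) ≠ 0 := by positivity
  generalize ((q:ℝ) ^ 2) ^ (m' * k') = A at *
  generalize ((q:ℝ) ^ 2) ^ ((j + m') * (j + k')) = B at *
  generalize (q:ℝ) ^ (2 * n * j) = D at *
  generalize (q:ℝ) ^ (j ^ 2) = P at *
  have hA : A = P * (P * B) / D := by rw [← e3]; field_simp
  rw [hA]
  field_simp

lemma rho_bound {q : ℕ} (hK : Fintype.card K = q ^ 2) (σ : K →+* K) (hσ : ∀ x : K, σ x = x ^ q)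
    (j : ℕ) (p : ℕ × ℕ) : |rho σ q j p| ≤ Real.exp 1 / ginfty ((q:ℝ) ^ 2) ^ 3 := by
  obtain ⟨k, m⟩ := p
  have hq2r : (2:ℝ) ≤ q := by exact_mod_cast two_le_q hK
  have hQ : (1:ℝ) < (q:ℝ) ^ 2 := by nlinarith
  have hg := ginfty_pos hQ
  by_cases h : k < j ∨ m < j
  · rw [rho, SS_zero hK σ hσ h]; simp; positivity
  · push Not at h
    rw [rho_eq hK σ hσ h.1 h.2]
    have p := fun i => ee_pos hQ i
    have l := fun i => ee_le_one hQ i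
    have g := fun i => ginfty_le_ee hQ i
    have hu := uu_nonneg σ q (m + k) j
    have p1 := p (m - j + (k - j)); have p2 := p m; have p3 := p k; have p4 := p (m - j)
    have p5 := p (k - j); have p6 := p (m + k)
    rw [abs_of_nonneg (by positivity), ← mul_one_div (Real.exp 1)]
    refine mul_le_mul (uu_le hK σ hσ _ _ (by omega)) ?_ (by positivity) (by positivity)
    refine div_le_div₀ zero_le_one ?_ (by positivity) ?_
    · exact mul_le_one₀ (mul_le_one₀ (l _) p2.le (l _)) p3.le (l _)
    · rw [pow_succ, sq]
      have g1 := g (m - j); have g2 := g (k - j); have g3 := g (m + k)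
      gcongr

lemma rho_tendsto {q : ℕ} (hK : Fintype.card K = q ^ 2) (σ : K →+* K) (hσ : ∀ x : K, σ x = x ^ q)
    (j : ℕ) : Tendsto (rho σ q j) atTop (𝓝 1) := by
  have hq2r : (2:ℝ) ≤ q := by exact_mod_cast two_le_q hK
  have hQ : (1:ℝ) < (q:ℝ) ^ 2 := by nlinarith
  have hg := (ginfty_pos hQ).ne'
  have t1 : Tendsto (fun p : ℕ × ℕ => p.1) atTop atTop := by
    rw [← prod_atTop_atTop_eq]; exact tendsto_fst
  have t2 : Tendsto (fun p : ℕ × ℕ => p.2) atTop atTop := by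
    rw [← prod_atTop_atTop_eq]; exact tendsto_snd
  have t1j : Tendsto (fun p : ℕ × ℕ => p.1 - j) atTop atTop := (tendsto_sub_atTop_nat j).comp t1
  have t2j : Tendsto (fun p : ℕ × ℕ => p.2 - j) atTop atTop := (tendsto_sub_atTop_nat j).comp t2
  have t12 : Tendsto (fun p : ℕ × ℕ => p.2 + p.1) atTop atTop := t2.atTop_add_atTop t1
  have t12j : Tendsto (fun p : ℕ × ℕ => p.2 - j + (p.1 - j)) atTop atTop := t2j.atTop_add_atTop t1j
  have E := ee_tendsto hQ
  have H := ((uu_tendsto hK σ hσ j).comp t12).mul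
    ((((E.comp t12j).mul (E.comp t2)).mul (E.comp t1)).div
      (((E.comp t2j).mul (E.comp t1j)).mul (E.comp t12)) (by positivity))
  rw [div_self (by positivity), one_mul] at H
  refine H.congr' ?_
  filter_upwards [t1.eventually_ge_atTop j, t2.eventually_ge_atTop j] with p h1 h2
  exact (rho_eq hK σ hσ h1 h2).symm

lemma count_eq {q : ℕ} (hK : Fintype.card K = q ^ 2) (σ : K →+* K) (hσ : ∀ x : K, σ x = x ^ q)
    (l m k : ℕ) :
    (Nat.card {C : Submodule K (Fin (m + k) → K) //
      Module.finrank K C = k ∧ Module.finrank K ↥(C ⊓ hermDual σ C) = l} : ℝ) /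
      gaussBinom ((q:ℝ) ^ 2) (m + k) k
    = ∑' i : ℕ, (q:ℝ) ^ l / hpoly ((q:ℝ) ^ 2) l * ((-(q:ℝ)⁻¹) ^ i / ee ((q:ℝ) ^ 2) i)
        * rho σ q (l + i) (k, m) := by
  classical
  have hq2r : (2:ℝ) ≤ q := by exact_mod_cast two_le_q hK
  have hq0 : (q:ℝ) ≠ 0 := by positivity
  have hQ : (1:ℝ) < (q:ℝ) ^ 2 := by nlinarith
  letI : Fintype {C : Submodule K (Fin (m + k) → K) // Module.finrank K C = k} := Fintype.ofFinite _
  have h1 : (Nat.card {C : Submodule K (Fin (m + k) → K) //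
      Module.finrank K C = k ∧ Module.finrank K ↥(C ⊓ hermDual σ C) = l} : ℝ)
      = ∑ C : {C : Submodule K (Fin (m + k) → K) // Module.finrank K C = k},
        if Module.finrank K ↥(C.1 ⊓ hermDual σ C.1) = l then (1:ℝ) else 0 := by
    rw [Finset.sum_boole, ← Fintype.card_subtype, ← Nat.card_eq_fintype_card]
    norm_cast
    exact (Nat.card_congr (Equiv.subtypeSubtypeEquivSubtypeInter _ _)).symm
  have h2 : (Nat.card {C : Submodule K (Fin (m + k) → K) //
      Module.finrank K C = k ∧ Module.finrank K ↥(C ⊓ hermDual σ C) = l} : ℝ)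
      = ∑ i ∈ range (k + 1), cc ((q:ℝ) ^ 2) l i * SS σ q (m + k) k (l + i) := by
    rw [h1]
    simp_rw [SS, Finset.mul_sum]
    rw [Finset.sum_comm]
    refine Finset.sum_congr rfl fun C _ => ?_
    rw [lagr_delta hQ]
    have h2 : Module.finrank K ↥(C.1 ⊓ hermDual σ C.1) ≤ Module.finrank K C.1 :=
      Submodule.finrank_mono inf_le_left
    rw [C.2] at h2
    omega
  rw [h2, tsum_eq_sum (s := range (k + 1))]
  · rw [Finset.sum_div]
    refine Finset.sum_congr rfl fun i _ => ?_
    rw [← cc_eq (by linarith : (1:ℝ) < q), rho]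
    simp only
    field_simp
  · intro i hi
    rw [rho, SS_zero hK σ hσ (Or.inl (by simp at hi; omega))]
    simp

lemma main_tendsto {q : ℕ} (hK : Fintype.card K = q ^ 2) (σ : K →+* K) (hσ : ∀ x : K, σ x = x ^ q)
    (l : ℕ) :
    Tendsto (fun p : ℕ × ℕ => (Nat.card {C : Submodule K (Fin (p.2 + p.1) → K) //
      Module.finrank K C = p.1 ∧ Module.finrank K ↥(C ⊓ hermDual σ C) = l} : ℝ) /
      gaussBinom ((q:ℝ) ^ 2) (p.2 + p.1) p.1) atTop
      (𝓝 ((q : ℝ) ^ l * ginfty (q : ℝ) * ginfty ((q : ℝ) ^ 4) /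
          (hpoly ((q : ℝ) ^ 2) l * (ginfty ((q : ℝ) ^ 2) * ginfty ((q : ℝ) ^ 2))))) := by
  have hq2r : (2:ℝ) ≤ q := by exact_mod_cast two_le_q hK
  have hq1 : (1:ℝ) < q := by linarith
  have hQ : (1:ℝ) < (q:ℝ) ^ 2 := by nlinarith
  obtain ⟨hs, he⟩ := euler_sum hq1
  have hp := prod_id hq1
  have hg := (ginfty_pos hQ).ne'
  simp_rw [count_eq hK σ hσ]
  have hlim : (q : ℝ) ^ l * ginfty (q : ℝ) * ginfty ((q : ℝ) ^ 4) /
          (hpoly ((q : ℝ) ^ 2) l * (ginfty ((q : ℝ) ^ 2) * ginfty ((q : ℝ) ^ 2)))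
      = ∑' i : ℕ, (q:ℝ) ^ l / hpoly ((q:ℝ) ^ 2) l * ((-(q:ℝ)⁻¹) ^ i / ee ((q:ℝ) ^ 2) i) := by
    rw [tsum_mul_left, mul_assoc ((q:ℝ) ^ l), mul_div_mul_comm]
    congr 1
    rw [div_eq_iff (by positivity), ← hp, ← mul_assoc, he, one_mul]
  rw [hlim]
  refine tendsto_tsum_of_dominated_convergence (bound := fun i =>
    |(q:ℝ) ^ l / hpoly ((q:ℝ) ^ 2) l * ((-(q:ℝ)⁻¹) ^ i / ee ((q:ℝ) ^ 2) i)|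
      * (Real.exp 1 / ginfty ((q:ℝ) ^ 2) ^ 3)) ?_ ?_ ?_
  · exact ((hs.mul_left _).abs).mul_right _
  · intro i
    simpa using (rho_tendsto hK σ hσ (l + i)).const_mul
      ((q:ℝ) ^ l / hpoly ((q:ℝ) ^ 2) l * ((-(q:ℝ)⁻¹) ^ i / ee ((q:ℝ) ^ 2) i))
  · refine Eventually.of_forall fun p i => ?_
    rw [norm_mul, Real.norm_eq_abs, Real.norm_eq_abs]
    exact mul_le_mul_of_nonneg_left (rho_bound hK σ hσ _ _) (abs_nonneg _)

end assemble

/-- For fixed hull dimension `ℓ`, as `k → ∞` and `n - k → ∞`, the ratio of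
the number of linear `[n,k]_{q²}` codes with `ℓ`-dimensional Hermitian hull to the Gaussian
binomial `[n choose k]_{q²}` converges to
`q^ℓ g_{q,∞} g_{q⁴,∞} / (h_{q²,ℓ} g_{q²,∞} g_{q²,∞})`. -/
theorem hermitian_hull_asymptotics
    (q : ℕ) (hq : IsPrimePow q)
    {K : Type*} [Field K] [Fintype K] (hK : Fintype.card K = q ^ 2)
    (σ : K →+* K) (hσ : ∀ x : K, σ x = x ^ q)
    (ℓ : ℕ) :
    ∀ ε : ℝ, 0 < ε → ∃ N : ℕ, ∀ n k : ℕ,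
      N ≤ k → N ≤ n - k → ℓ ≤ k → k + ℓ ≤ n →
      |(Nat.card {C : Submodule K (Fin n → K) //
            Module.finrank K C = k ∧ Module.finrank K ↥(C ⊓ hermDual σ C) = ℓ} : ℝ) /
          gaussBinom ((q : ℝ) ^ 2) n k -
        (q : ℝ) ^ ℓ * ginfty (q : ℝ) * ginfty ((q : ℝ) ^ 4) /
          (hpoly ((q : ℝ) ^ 2) ℓ * (ginfty ((q : ℝ) ^ 2) * ginfty ((q : ℝ) ^ 2)))| < ε := by
  intro ε hε
  have h := (Metric.tendsto_nhds.1 (main_tendsto hK σ hσ ℓ)) ε hε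
  obtain ⟨⟨a, b⟩, hab⟩ := Filter.eventually_atTop.1 h
  refine ⟨max a b, fun n k hk hnk _ hkn => ?_⟩
  have h1 := hab (k, n - k) ⟨(le_max_left a b).trans hk, (le_max_right a b).trans hnk⟩
  obtain ⟨m, rfl⟩ : ∃ m, n = m + k := ⟨n - k, by omega⟩
  rw [Nat.add_sub_cancel] at h1
  exact h1
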